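/- arXiv:2312.14072 — 2 statements merged into one kernel-verified Lean document; each statement's English description precedes it below -/
import Mathlib

section
/- Let ω > 0 be a real number, let I ≥ 1 be a natural number, and let p : ℕ → ℝ satisfy 0 ≤ p(m) ≤ 1 for all m. Define P(k) = p(k)·∏_{m=1}^{k-1}(1 − p(m)) for each k, p_err = ∏_{m=1}^{I}(1 − p(m)), p₀ = ∑_{k=1}^{I-1} P(k), and p₁ = ∑_{k=1}^{I-1} k·P(k). If p_err < 1, then the double series ∑_{j=0}^{∞} ∑_{k=1}^{I-1} ((j·I + k)/ω) · p_err^j · P(k) converges and equals (1/ω)·( I·p₀·p_err/(1 − p_err)² + p₁/(1 − p_err) ), which can equivalently be written as (1/(ω(1 − p_err)))·( p₁ + I·p₀·p_err/(1 − p_err) ). -/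
/-- Lemma 4 (average rate of orientation-change VAMs): with
`P(k) = p(k) ∏_{m=1}^{k-1}(1 - p(m))`, `p_err = ∏_{m=1}^{I}(1 - p(m))`,
`p₀ = ∑_{k=1}^{I-1} P(k)` and `p₁ = ∑_{k=1}^{I-1} k P(k)`, if `p_err < 1` the
double series `∑_{j≥0} ∑_{k=1}^{I-1} ((jI + k)/ω) p_err^j P(k)` converges to
`(1/ω)(I p₀ p_err/(1-p_err)² + p₁/(1-p_err))`, equivalently
`(1/(ω(1-p_err)))(p₁ + I p₀ p_err/(1-p_err))`. -/
theorem avg_orientation_vam_rate (ω : ℝ) (hω : 0 < ω) (I : ℕ) (hI : 1 ≤ I)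
    (p : ℕ → ℝ) (hp : ∀ m, 0 ≤ p m ∧ p m ≤ 1)
    (P : ℕ → ℝ) (hP : ∀ k, P k = p k * ∏ m ∈ Finset.Ico 1 k, (1 - p m))
    (perr p₀ p₁ : ℝ)
    (hperr : perr = ∏ m ∈ Finset.Icc 1 I, (1 - p m))
    (hp₀ : p₀ = ∑ k ∈ Finset.Ico 1 I, P k)
    (hp₁ : p₁ = ∑ k ∈ Finset.Ico 1 I, (k : ℝ) * P k)
    (hlt : perr < 1) :
    HasSum
      (fun j : ℕ => ∑ k ∈ Finset.Ico 1 I,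
        ((j * I + k : ℕ) : ℝ) / ω * (perr ^ j * P k))
      ((1 / ω) * ((I : ℝ) * p₀ * perr / (1 - perr) ^ 2 + p₁ / (1 - perr)))
    ∧ (1 / ω) * ((I : ℝ) * p₀ * perr / (1 - perr) ^ 2 + p₁ / (1 - perr))
        = (1 / (ω * (1 - perr))) * (p₁ + (I : ℝ) * p₀ * perr / (1 - perr)) := by
  have hnonneg : 0 ≤ perr := hperr ▸ Finset.prod_nonneg fun m _ => sub_nonneg.2 (hp m).2
  have hω' : ω ≠ 0 := hω.ne'
  have hne : 1 - perr ≠ 0 := (sub_pos.2 hlt).ne'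
  have hnorm : ‖perr‖ < 1 := by rwa [Real.norm_of_nonneg hnonneg]
  refine ⟨?_, by field_simp; ring⟩
  convert! ((hasSum_coe_mul_geometric_of_norm_lt_one hnorm).mul_left (I * p₀ / ω)).add
    ((hasSum_geometric_of_lt_one hnonneg hlt).mul_left (p₁ / ω)) using 1
  · funext j
    rw [hp₀, hp₁, Finset.mul_sum, Finset.sum_div, Finset.sum_div, Finset.sum_mul,
      Finset.sum_mul, ← Finset.sum_add_distrib]
    refine Finset.sum_congr rfl fun k _ => ?_
    push_cast
    ring
  · field_simp
end

section
/- Let p > 0, R_h > 0, R_s > 0, κ ∈ ℝ, x₀ ∈ ℝ, and θ ∈ ℝ. Suppose 0 < r < R_h and set H = p·exp( 1/((r/R_h)² − 1) ) / ( 1 + exp( −(cos(κθ) − x₀)/R_s ) ). Then log( (H/p)·(1 + exp( −(cos(κθ) − x₀)/R_s )) ) = 1/((r/R_h)² − 1), this quantity lies in (−∞, −1), its reciprocal lies in (−1, 0), and r = R_h·√( 1 + 1/ log( (H/p)·(1 + exp( −(cos(κθ) − x₀)/R_s )) ) ). -/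
/-- Appendix B isoline-radius inversion: for `0 < r < R_h` and
`H = p e^{1/((r/R_h)²-1)} / (1 + e^{-(cos(κθ)-x₀)/R_s})`, the logarithm
`log((H/p)(1 + e^{-(cos(κθ)-x₀)/R_s}))` equals `1/((r/R_h)²-1)`, lies in
`(-∞,-1)`, its reciprocal lies in `(-1,0)`, and
`r = R_h √(1 + 1/log(·))`. -/
theorem isoline_radius_inversion (p Rh Rs κ x₀ θ r H : ℝ)
    (hp : 0 < p) (hRh : 0 < Rh) (hRs : 0 < Rs) (hr0 : 0 < r) (hr : r < Rh)
    (hH : H = p * Real.exp (1 / ((r / Rh) ^ 2 - 1))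
      / (1 + Real.exp (-(Real.cos (κ * θ) - x₀) / Rs))) :
    Real.log ((H / p) * (1 + Real.exp (-(Real.cos (κ * θ) - x₀) / Rs)))
        = 1 / ((r / Rh) ^ 2 - 1)
    ∧ 1 / ((r / Rh) ^ 2 - 1) < -1
    ∧ (-1 < 1 / (1 / ((r / Rh) ^ 2 - 1)) ∧ 1 / (1 / ((r / Rh) ^ 2 - 1)) < 0)
    ∧ r = Rh * Real.sqrt (1 + 1 /
        Real.log ((H / p) * (1 + Real.exp (-(Real.cos (κ * θ) - x₀) / Rs)))) := by
  have hpos : 0 < r / Rh := div_pos hr0 hRh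
  have hsq_pos : 0 < (r / Rh) ^ 2 := pow_pos hpos 2
  have hsq_lt : (r / Rh) ^ 2 < 1 :=
    pow_lt_one₀ hpos.le ((div_lt_one hRh).2 hr) two_ne_zero
  have hlog : Real.log ((H / p) * (1 + Real.exp (-(Real.cos (κ * θ) - x₀) / Rs)))
      = 1 / ((r / Rh) ^ 2 - 1) := by
    have hden : 1 + Real.exp (-(Real.cos (κ * θ) - x₀) / Rs) ≠ 0 := by positivity
    rw [hH, div_right_comm, div_mul_cancel₀ _ hden, mul_div_cancel_left₀ _ hp.ne',
      Real.log_exp]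
  refine ⟨hlog, ?_, ⟨?_, ?_⟩, ?_⟩
  · rw [div_lt_iff_of_neg (by linarith)]
    linarith
  · rw [one_div_one_div]
    linarith
  · rw [one_div_one_div]
    linarith
  · rw [hlog, one_div_one_div, add_sub_cancel, Real.sqrt_sq hpos.le,
      mul_div_cancel₀ _ hRh.ne']
end
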